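/- The no-retraction theorem: Let δ ⊆ ℝ^d be a geometric n-simplex with n ≥ 1 and let bd δ be its geometric boundary, the union of its proper faces. Then there is no continuous map r: δ → bd δ that restricts to the identity on bd δ. -/

import Mathlib

/-- The geometric boundary of the geometric simplex with vertices `v 0, …, v n`:
the union of its proper faces, i.e. of the convex hulls of the images of the
proper subsets of the index set. -/
def simplexBoundary {d n : ℕ} (v : Fin (n + 1) → EuclideanSpace ℝ (Fin d)) :
    Set (EuclideanSpace ℝ (Fin d)) :=
  ⋃ (t : Finset (Fin (n + 1))) (_ : t ≠ Finset.univ), convexHull ℝ (v '' ↑t)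

open MeasureTheory Metric Set

/-- A Lipschitz map on a closed ball that vanishes on the sphere stays Lipschitz, with the same
constant, when extended by zero. -/
theorem LipschitzOnWith.indicator_closedBall {E F : Type*} [NormedAddCommGroup E]
    [NormedSpace ℝ E] [NormedAddCommGroup F] {k : E → F} {K : NNReal} {R : ℝ}
    (hk : LipschitzOnWith K k (closedBall 0 R)) (h0 : ∀ x, ‖x‖ = R → k x = 0) :
    LipschitzWith K ((closedBall 0 R).indicator k) := by
  have key : ∀ x y : E, ‖x‖ ≤ R → R < ‖y‖ → dist (k x) 0 ≤ K * dist x y := by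
    intro x y hx hy
    have hc : ContinuousOn (fun s : ℝ => ‖AffineMap.lineMap x y s‖) (Icc 0 1) := by
      have : Continuous (fun s : ℝ => AffineMap.lineMap x y s) := AffineMap.lineMap_continuous
      exact this.norm.continuousOn
    obtain ⟨s, hs, hsR⟩ := intermediate_value_Icc zero_le_one hc
      (show R ∈ Icc _ _ by simpa using ⟨hx, hy.le⟩)
    have h1 := hk.dist_le_mul x (by simpa using hx) (AffineMap.lineMap x y s)
      (by simpa using hsR.le)
    rw [h0 _ hsR, dist_left_lineMap, Real.norm_of_nonneg hs.1] at h1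
    refine h1.trans (mul_le_mul_of_nonneg_left ?_ K.2)
    exact mul_le_of_le_one_left dist_nonneg hs.2
  refine LipschitzWith.of_dist_le_mul fun x y => ?_
  by_cases hx : ‖x‖ ≤ R <;> by_cases hy : ‖y‖ ≤ R
  · simpa [indicator, hx, hy] using hk.dist_le_mul x (by simpa using hx) y (by simpa using hy)
  · simpa [indicator, hx, hy] using key x y hx (not_le.1 hy)
  · rw [dist_comm, dist_comm x]
    simpa [indicator, hx, hy] using key y x hy (not_le.1 hx)
  · simp only [indicator, mem_closedBall, dist_zero_right, hx, hy, if_false, dist_self]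
    positivity

/-- A perturbation of the identity by a strict contraction is bijective. -/
theorem LipschitzWith.bijective_id_add {E : Type*} [NormedAddCommGroup E] [CompleteSpace E]
    {g : E → E} {K : NNReal} (hg : LipschitzWith K g) (hK : K < 1) :
    Function.Bijective fun x => x + g x := by
  have hc : ∀ y, ContractingWith K fun x => y - g x := fun y =>
    ⟨hK, LipschitzWith.of_dist_le_mul fun a b => by
      rw [dist_sub_left]
      exact hg.dist_le_mul a b⟩
  constructor
  · intro a b hab
    refine (hc (a + g a)).fixedPoint_unique' (x := a) (y := b) ?_ ?_
    · simp [Function.IsFixedPt]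
    · simp only at hab
      simp [Function.IsFixedPt, hab]
  · intro y
    refine ⟨ContractingWith.fixedPoint _ (hc y), ?_⟩
    have := (hc y).fixedPoint_isFixedPt
    simp only [Function.IsFixedPt] at this
    exact (sub_eq_iff_eq_add.1 this).symm

/-- `t ↦ det (1 + t L)` is a polynomial of degree at most the dimension. -/
theorem ContinuousLinearMap.exists_polynomial_det_one_add_smul {E : Type*} [NormedAddCommGroup E]
    [NormedSpace ℝ E] [FiniteDimensional ℝ E] (L : E →L[ℝ] E) :
    ∃ p : Polynomial ℝ, p.natDegree ≤ Module.finrank ℝ E ∧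
      ∀ t : ℝ, p.eval t = (1 + t • L).det := by
  classical
  let b := Module.finBasis ℝ E
  let A := LinearMap.toMatrix b b (L : E →ₗ[ℝ] E)
  refine ⟨Matrix.det ((Polynomial.X : Polynomial ℝ) • A.map Polynomial.C +
    (1 : Matrix _ _ ℝ).map Polynomial.C), ?_, fun t => ?_⟩
  · simpa using Polynomial.natDegree_det_X_add_C_le A 1
  · rw [ContinuousLinearMap.det, ← LinearMap.det_toMatrix b, ← Polynomial.coe_evalRingHom,
      RingHom.map_det]
    congr 1
    have : ((1 + t • L : E →L[ℝ] E) : E →ₗ[ℝ] E) = LinearMap.id + t • (L : E →ₗ[ℝ] E) := rfl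
    rw [this, map_add (LinearMap.toMatrix b b), map_smul (LinearMap.toMatrix b b),
      LinearMap.toMatrix_id]
    ext i j
    simp [A, add_comm, mul_comm t, Matrix.one_apply, apply_ite]

/-- If `k` is `C¹`, vanishes on the sphere of radius `R`, and `t k` is a strict contraction, then
`x ↦ x + t k x` preserves the volume of the ball of radius `R`. -/
theorem integral_det_one_add_smul_fderiv {E : Type*} [NormedAddCommGroup E] [NormedSpace ℝ E]
    [FiniteDimensional ℝ E] [MeasurableSpace E] [BorelSpace E] (μ : Measure E)
    [μ.IsAddHaarMeasure] {k : E → E} {K : NNReal} {R t : ℝ} (hkd : ContDiff ℝ 1 k)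
    (hk : LipschitzOnWith K k (closedBall 0 R)) (h0 : ∀ x, ‖x‖ = R → k x = 0)
    (ht : ‖t‖ * K < 1) (hdet : ∀ x ∈ ball (0 : E) R, 0 ≤ (1 + t • fderiv ℝ k x).det) :
    ∫ x in ball 0 R, (1 + t • fderiv ℝ k x).det ∂μ = μ.real (ball 0 R) := by
  set g : E → E := (closedBall 0 R).indicator k with hg
  have hgL : LipschitzWith (‖t‖₊ * K) fun x => t • g x :=
    (lipschitzWith_smul t).comp (hk.indicator_closedBall h0)
  have hbij := hgL.bijective_id_add (by exact_mod_cast ht)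
  set f : E → E := fun x => x + t • g x with hf
  have hfout : ∀ x, R ≤ ‖x‖ → f x = x := by
    intro x hx
    have : g x = 0 := by
      rcases hx.eq_or_lt with h | h
      · simp [hg, indicator, h0 x h.symm]
      · simp [hg, h.not_ge]
    simp [hf, this]
  have himg : f '' ball 0 R = ball 0 R := by
    apply Subset.antisymm
    · rintro _ ⟨x, hx, rfl⟩
      by_contra hn
      have h1 : f (f x) = f x := hfout _ (by simpa using hn)
      rw [hbij.1 h1] at hn
      exact hn hx
    · intro y hy
      obtain ⟨x, rfl⟩ := hbij.2 y
      refine ⟨x, ?_, rfl⟩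
      by_contra hn
      have h1 : f x = x := hfout _ (by simpa using hn)
      exact hn (h1 ▸ hy)
  have hderiv : ∀ x ∈ ball (0 : E) R,
      HasFDerivWithinAt f (1 + t • fderiv ℝ k x) (ball 0 R) x := by
    intro x hx
    have h1 : HasFDerivAt (fun x => x + t • k x) (1 + t • fderiv ℝ k x) x :=
      (hasFDerivAt_id x).add
        (((hkd.differentiable one_ne_zero) x).hasFDerivAt.const_smul t)
    refine h1.hasFDerivWithinAt.congr (fun y hy => ?_) ?_
    · simp [hf, hg, indicator_of_mem (ball_subset_closedBall hy)]
    · simp [hf, hg, indicator_of_mem (ball_subset_closedBall hx)]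
  have hcv := lintegral_abs_det_fderiv_eq_addHaar_image μ measurableSet_ball hderiv hbij.1.injOn
  have hcont : Continuous fun x => (1 + t • fderiv ℝ k x).det :=
    ContinuousLinearMap.continuous_det.comp
      (continuous_const.add ((hkd.continuous_fderiv one_ne_zero).const_smul t))
  rw [himg] at hcv
  rw [integral_eq_lintegral_of_nonneg_ae _ hcont.aestronglyMeasurable, measureReal_def, ← hcv]
  · congr 1
    refine setLIntegral_congr_fun measurableSet_ball fun x hx => ?_
    simp only [abs_of_nonneg (hdet x hx)]
  · exact (ae_restrict_iff' measurableSet_ball).2 (Filter.Eventually.of_forall hdet)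

section InnerProductSpace

variable {E : Type*} [NormedAddCommGroup E] [InnerProductSpace ℝ E] [FiniteDimensional ℝ E]

theorem det_fderiv_eq_zero_of_norm_eq {H : E → E} {R : ℝ} (hR : 0 < R) (hH : Differentiable ℝ H)
    (hn : ∀ x, ‖H x‖ = R) (x : E) : (fderiv ℝ H x).det = 0 := by
  by_contra hdet
  have h1 := (hH x).hasFDerivAt.norm_sq
  simp only [hn] at h1
  have h2 := h1.unique (hasFDerivAt_const (R ^ 2) x)
  obtain ⟨v, hv⟩ := (ContinuousLinearMap.toContinuousLinearEquivOfDetNeZero _ hdet).surjective (H x)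
  rw [ContinuousLinearMap.toContinuousLinearEquivOfDetNeZero_apply] at hv
  have h3 := congrArg (fun L : E →L[ℝ] ℝ => L v) h2
  simp [hv, hn, hR.ne'] at h3

/-- There is no `C¹` map of constant norm `R > 0` that fixes the sphere of radius `R`. -/
theorem ContDiff.exists_ne_of_norm_eq {H : E → E} {R : ℝ} (hR : 0 < R) (hH : ContDiff ℝ 1 H)
    (hn : ∀ x, ‖H x‖ = R) : ∃ x, ‖x‖ = R ∧ H x ≠ x := by
  by_contra! hfix
  borelize E
  let μ : Measure E := Measure.addHaar
  let k : E → E := fun x => H x - x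
  have hkd : ContDiff ℝ 1 k := hH.sub contDiff_id
  have h0 : ∀ x, ‖x‖ = R → k x = 0 := fun x hx => sub_eq_zero.2 (hfix x hx)
  obtain ⟨K, hK⟩ := hkd.contDiffOn.exists_lipschitzOnWith one_ne_zero
    (convex_closedBall (0 : E) R) (isCompact_closedBall 0 R)
  have hnorm : ∀ x ∈ ball (0 : E) R, ‖fderiv ℝ k x‖ ≤ K := fun x hx =>
    norm_fderiv_le_of_lipschitzOn ℝ (closedBall_mem_nhds_of_mem hx) hK
  obtain ⟨δ, hδ, hdet⟩ : ∃ δ > 0, ∀ M : E →L[ℝ] E, ‖M‖ < δ → 0 < (1 + M).det := by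
    have hc : Continuous fun M : E →L[ℝ] E => (1 + M).det :=
      ContinuousLinearMap.continuous_det.comp (continuous_const.add continuous_id)
    have h1 : 0 < (1 + (0 : E →L[ℝ] E)).det := by
      rw [add_zero, ContinuousLinearMap.det]
      change 0 < LinearMap.det LinearMap.id
      simp
    obtain ⟨δ, hδ, h⟩ := Metric.eventually_nhds_iff.1 (hc.continuousAt.eventually_const_lt h1)
    exact ⟨δ, hδ, fun M hM => h (by simpa using hM)⟩
  obtain ⟨c, hc, hcK⟩ := exists_pos_mul_lt (lt_min one_pos hδ) (K : ℝ)
  let N := Module.finrank ℝ E + 1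
  let t : ℕ → ℝ := fun j => c / (j + 1)
  have ht0 : ∀ j, 0 < t j := fun j => by positivity
  have htc : ∀ j, t j * K < min 1 δ := fun j => by
    refine lt_of_le_of_lt ?_ hcK
    rw [mul_comm]
    refine mul_le_mul_of_nonneg_left ?_ K.2
    exact div_le_self hc.le (by linarith [j.cast_nonneg (α := ℝ)])
  have htinj : Set.InjOn t (Finset.range N) := by
    intro i _ j _ hij
    have hi : (i : ℝ) + 1 ≠ 0 := by positivity
    have hj : (j : ℝ) + 1 ≠ 0 := by positivity
    simp only [t] at hij
    rw [div_eq_div_iff hi hj, mul_right_inj' hc.ne'] at hij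
    exact_mod_cast (add_right_cancel hij).symm
  have hint : ∀ j, ∫ x in ball 0 R, (1 + t j • fderiv ℝ k x).det ∂μ = μ.real (ball 0 R) := by
    intro j
    refine integral_det_one_add_smul_fderiv μ hkd hK h0 ?_ fun x hx => (hdet _ ?_).le
    · rw [Real.norm_of_nonneg (ht0 j).le]
      exact (htc j).trans_le (min_le_left _ _)
    · rw [norm_smul, Real.norm_of_nonneg (ht0 j).le]
      exact ((mul_le_mul_of_nonneg_left (hnorm x hx) (ht0 j).le).trans_lt (htc j)).trans_le
        (min_le_right _ _)
  let ℓ : ℕ → ℝ := fun j => (Lagrange.basis (Finset.range N) t j).eval 1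
  have hℓ : ∑ j ∈ Finset.range N, ℓ j = 1 := by
    simp only [ℓ]
    rw [← Polynomial.eval_finsetSum, Lagrange.sum_basis htinj ⟨0, by simp [N]⟩,
      Polynomial.eval_one]
  have hinterp : ∀ x,
      ∑ j ∈ Finset.range N, (1 + t j • fderiv ℝ k x).det * ℓ j = 0 := by
    intro x
    obtain ⟨p, hp, hpe⟩ := (fderiv ℝ k x).exists_polynomial_det_one_add_smul
    have hpd : p.degree < (Finset.range N).card := by
      refine lt_of_le_of_lt Polynomial.degree_le_natDegree ?_
      rw [Finset.card_range]
      exact_mod_cast Nat.lt_succ_of_le hp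
    have h1 := congrArg (Polynomial.eval 1) (Lagrange.eq_interpolate htinj hpd)
    rw [Lagrange.interpolate_apply, Polynomial.eval_finsetSum, hpe] at h1
    have h2 : 1 + (1 : ℝ) • fderiv ℝ k x = fderiv ℝ H x := by
      have : fderiv ℝ k x = fderiv ℝ H x - 1 := by
        exact ((hH.differentiable one_ne_zero x).hasFDerivAt.sub (hasFDerivAt_id x)).fderiv
      rw [this, one_smul, add_sub_cancel]
    rw [h2, det_fderiv_eq_zero_of_norm_eq hR (hH.differentiable one_ne_zero) hn] at h1
    simpa [hpe] using h1.symm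
  have hintegrable : ∀ j, Integrable (fun x => (1 + t j • fderiv ℝ k x).det * ℓ j)
      (μ.restrict (ball 0 R)) := by
    intro j
    have hcont : Continuous fun x => (1 + t j • fderiv ℝ k x).det * ℓ j :=
      (ContinuousLinearMap.continuous_det.comp (continuous_const.add
        ((hkd.continuous_fderiv one_ne_zero).const_smul (t j)))).mul continuous_const
    exact (hcont.continuousOn.integrableOn_compact (isCompact_closedBall 0 R)).mono_set
      ball_subset_closedBall
  have hsum := integral_finsetSum (Finset.range N) fun j _ => hintegrable j
  simp only [hinterp, integral_zero, integral_mul_const, hint, ← Finset.mul_sum, hℓ, mul_one]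
    at hsum
  exact (ENNReal.toReal_pos (measure_ball_pos μ 0 hR).ne' measure_ball_lt_top.ne).ne hsum

/-- A continuous self-map of a finite-dimensional space that is the identity outside a bounded
set has a zero. -/
theorem Continuous.exists_eq_zero_of_eq_self_of_norm_gt {F : E → E} (hF : Continuous F) {r : ℝ}
    (hr : ∀ x, r < ‖x‖ → F x = x) : ∃ x, F x = 0 := by
  by_contra! hne
  obtain ⟨g, hg, hd, hs⟩ := (hF.sub continuous_id).exists_contDiff_approx 1 hF.norm
    fun x => norm_pos_iff.2 (hne x)
  let G : E → E := fun x => x + g x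
  have hG : ContDiff ℝ 1 G := contDiff_id.add hg
  have hG0 : ∀ x, G x ≠ 0 := by
    intro x hx
    have h1 := hd x
    have h2 : g x = -x := (neg_eq_of_add_eq_zero_right hx).symm
    simp [h2, dist_eq_norm, neg_sub_left] at h1
  let R := max r 0 + 1
  have hR : 0 < R := by positivity
  have hGout : ∀ x, ‖x‖ = R → G x = x := by
    intro x hx
    have h1 : F x = x := hr x (by rw [hx]; linarith [le_max_left r 0])
    have h2 : g x = 0 := by
      by_contra h
      exact hs h (by simp [h1])
    simp [G, h2]
  obtain ⟨x, hx, hne'⟩ := ContDiff.exists_ne_of_norm_eq (H := fun x => (R / ‖G x‖) • G x) hR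
    ((contDiff_const.div (hG.norm ℝ hG0) fun x => norm_ne_zero_iff.2 (hG0 x)).smul hG)
    fun x => by
      rw [norm_smul, norm_div, norm_norm, Real.norm_of_nonneg hR.le,
        div_mul_cancel₀ _ (norm_ne_zero_iff.2 (hG0 x))]
  simp [hGout x hx, hx, hR.ne'] at hne'

end InnerProductSpace

/-- Points of the convex hull of a finite family, as convex combinations of the whole family. -/
theorem mem_convexHull_image_iff_exists_weights {ι V : Type*} [Fintype ι] [AddCommGroup V]
    [Module ℝ V] (v : ι → V) (t : Set ι) (x : V) :
    x ∈ convexHull ℝ (v '' t) ↔ ∃ c : ι → ℝ, (∀ i, 0 ≤ c i) ∧ ∑ i, c i = 1 ∧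
      (∀ i ∉ t, c i = 0) ∧ ∑ i, c i • v i = x := by
  classical
  constructor
  · refine fun hx => convexHull_min (t := {x | ∃ c : ι → ℝ, (∀ i, 0 ≤ c i) ∧ ∑ i, c i = 1 ∧
      (∀ i ∉ t, c i = 0) ∧ ∑ i, c i • v i = x}) ?_ ?_ hx
    · rintro _ ⟨i, hi, rfl⟩
      refine ⟨Pi.single i 1, fun j => ?_, by simp, fun j hj => ?_, ?_⟩
      · by_cases h : j = i <;> simp [h]
      · exact Pi.single_eq_of_ne (by rintro rfl; exact hj hi) _
      · simp [Pi.single_apply, ite_smul]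
    · rintro _ ⟨c, hc, hc1, hct, rfl⟩ _ ⟨e, he, he1, het, rfl⟩ a b ha hb hab
      refine ⟨fun i => a * c i + b * e i, fun i => ?_, ?_, fun i hi => ?_, ?_⟩
      · have := hc i
        have := he i
        positivity
      · simp [Finset.sum_add_distrib, ← Finset.mul_sum, hc1, he1, hab]
      · simp [hct i hi, het i hi]
      · simp [Finset.smul_sum, add_smul, Finset.sum_add_distrib, mul_smul]
  · rintro ⟨c, hc, hc1, hct, rfl⟩
    have hsum : ∀ i ∉ Finset.univ.filter (· ∈ t), c i = 0 := fun i hi => hct i (by simpa using hi)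
    rw [← Finset.sum_subset (Finset.subset_univ (Finset.univ.filter (· ∈ t)))
      fun i _ hi => by rw [hsum i hi, zero_smul]]
    refine (convex_convexHull ℝ _).sum_mem (fun i _ => hc i) ?_ fun i hi => ?_
    · rw [← hc1]
      exact Finset.sum_subset (Finset.subset_univ _) fun i _ hi => hsum i hi
    · exact subset_convexHull ℝ _ ⟨i, by simpa using hi, rfl⟩

theorem mem_simplexBoundary_iff {d n : ℕ} (v : Fin (n + 1) → EuclideanSpace ℝ (Fin d))
    (x : EuclideanSpace ℝ (Fin d)) :
    x ∈ simplexBoundary v ↔ ∃ c : Fin (n + 1) → ℝ, (∀ i, 0 ≤ c i) ∧ ∑ i, c i = 1 ∧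
      (∃ i, c i = 0) ∧ ∑ i, c i • v i = x := by
  simp only [simplexBoundary, mem_iUnion, mem_convexHull_image_iff_exists_weights]
  constructor
  · rintro ⟨t, ht, c, hc, hc1, hct, hx⟩
    obtain ⟨i, hi⟩ : ∃ i, i ∉ t := by simpa [Finset.eq_univ_iff_forall] using ht
    exact ⟨c, hc, hc1, ⟨i, hct i hi⟩, hx⟩
  · rintro ⟨c, hc, hc1, ⟨i, hi⟩, hx⟩
    refine ⟨Finset.univ.erase i, fun h => ?_, c, hc, hc1, fun j hj => ?_, hx⟩
    · exact Finset.notMem_erase i Finset.univ (h.symm ▸ Finset.mem_univ i)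
    · obtain rfl : j = i := by simpa using hj
      exact hi

/-- The vectors of `EuclideanSpace ℝ ι` whose coordinates sum to zero. -/
def sumZeroSubmodule (ι : Type*) [Fintype ι] : Submodule ℝ (EuclideanSpace ℝ ι) where
  carrier := {x | ∑ i, x i = 0}
  add_mem' := by
    intro x y hx hy
    simp only [mem_ofPred_eq] at hx hy
    simp [Finset.sum_add_distrib, hx, hy]
  zero_mem' := by simp
  smul_mem' := by
    intro a x hx
    simp only [mem_ofPred_eq] at hx
    simp [← Finset.mul_sum, hx]

theorem AffineIndependent.exists_leftInverse_sum_smul {ι V : Type*} [Fintype ι]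
    [AddCommGroup V] [Module ℝ V] {v : ι → V} (hv : AffineIndependent ℝ v) :
    ∃ G : V →ₗ[ℝ] sumZeroSubmodule ι,
      ∀ x : sumZeroSubmodule ι, G (∑ i, (x : EuclideanSpace ℝ ι) i • v i) = x := by
  let L : sumZeroSubmodule ι →ₗ[ℝ] V := Fintype.linearCombination ℝ v ∘ₗ
    (WithLp.linearEquiv 2 ℝ (ι → ℝ)).toLinearMap ∘ₗ (sumZeroSubmodule ι).subtype
  have hL : ∀ x : sumZeroSubmodule ι, L x = ∑ i, (x : EuclideanSpace ℝ ι) i • v i := fun x => by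
    simp [L, Fintype.linearCombination_apply]
  have hker : LinearMap.ker L = ⊥ := by
    rw [LinearMap.ker_eq_bot']
    intro x hx
    rw [hL] at hx
    have h1 := (affineIndependent_iff.1 hv) Finset.univ (fun i => (x : EuclideanSpace ℝ ι) i)
      x.2 hx
    ext i
    exact h1 i (Finset.mem_univ i)
  obtain ⟨G, hG⟩ := L.exists_leftInverse_of_injective hker
  exact ⟨G, fun x => by rw [← hL]; exact LinearMap.congr_fun hG x⟩

/-- The no-retraction theorem: for `n ≥ 1` there is no continuous map from a geometric
`n`-simplex `δ ⊆ ℝ^d` to its geometric boundary restricting to the identity on the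
boundary. -/
theorem no_retraction (d n : ℕ) (hn : 1 ≤ n)
    (v : Fin (n + 1) → EuclideanSpace ℝ (Fin d)) (hv : AffineIndependent ℝ v) :
    ¬∃ r : EuclideanSpace ℝ (Fin d) → EuclideanSpace ℝ (Fin d),
        ContinuousOn r (convexHull ℝ (Set.range v)) ∧
        Set.MapsTo r (convexHull ℝ (Set.range v)) (simplexBoundary v) ∧
        ∀ x ∈ simplexBoundary v, r x = x := by
  classical
  rintro ⟨r, hrc, hrm, hrid⟩
  obtain ⟨G, hG⟩ := hv.exists_leftInverse_sum_smul
  let E := sumZeroSubmodule (Fin (n + 1))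
  let a : ℝ := 1 / (n + 1)
  have ha : 0 < a := by positivity
  have hna : ∑ _i : Fin (n + 1), a = 1 := by
    simp only [Finset.sum_const, Finset.card_univ, Fintype.card_fin, nsmul_eq_mul, a]
    push_cast
    field_simp
  let w : E → Fin (n + 1) → ℝ := fun x i => (x : EuclideanSpace ℝ (Fin (n + 1))) i + a
  have hw1 : ∀ x, ∑ i, w x i = 1 := fun x => by
    have hx : ∑ i, (x : EuclideanSpace ℝ (Fin (n + 1))) i = 0 := x.2
    rw [Finset.sum_add_distrib, hx, hna, zero_add]
  have hwc : ∀ i, Continuous fun x => w x i := fun i => by fun_prop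
  let A : E → EuclideanSpace ℝ (Fin d) := fun x => ∑ i, w x i • v i
  have hAc : Continuous A := continuous_finsetSum _ fun i _ => (hwc i).smul continuous_const
  let B : EuclideanSpace ℝ (Fin d) → E := fun y => G (y - ∑ i, a • v i)
  have hBc : Continuous B := G.continuous_of_finiteDimensional.comp
    (continuous_id.sub continuous_const)
  have hBA : ∀ x, B (A x) = x := fun x => by
    simp only [A, B, w, add_smul, Finset.sum_add_distrib, add_sub_cancel_right]
    exact hG x
  let K : Set E := {x | ∀ i, 0 ≤ w x i}
  have hK : IsClosed K := by
    simp only [K, ofPred_forall]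
    exact isClosed_iInter fun i => isClosed_le continuous_const (hwc i)
  have hAK : MapsTo A K (convexHull ℝ (range v)) := fun x hx => by
    rw [← image_univ, mem_convexHull_image_iff_exists_weights]
    exact ⟨w x, hx, hw1 x, by simp, rfl⟩
  have hfr : ∀ x ∈ frontier K, B (r (A x)) = x := by
    intro x hx
    have hxK : x ∈ K := hK.frontier_subset hx
    have hex : ∃ i, w x i = 0 := by
      by_contra! hne
      refine hx.2 (mem_interior.2 ⟨{x | ∀ i, 0 < w x i}, fun y hy i => (hy i).le, ?_,
        fun i => (hxK i).lt_of_ne (hne i).symm⟩)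
      simp only [ofPred_forall]
      exact isOpen_iInter_of_finite fun i => isOpen_lt continuous_const (hwc i)
    rw [hrid (A x) ((mem_simplexBoundary_iff v _).2 ⟨w x, hxK, hw1 x, hex, rfl⟩), hBA]
  have hF : Continuous fun x => if x ∈ K then B (r (A x)) else x := by
    refine continuous_if hfr ?_ continuous_id.continuousOn
    rw [ofPred_mem_eq, hK.closure_eq]
    exact hBc.comp_continuousOn (hrc.comp hAc.continuousOn hAK)
  have hout : ∀ x, √(n + 1) < ‖x‖ → (if x ∈ K then B (r (A x)) else x) = x := by
    intro x hx
    refine if_neg fun hxK => hx.not_ge ?_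
    rw [Submodule.coe_norm, EuclideanSpace.norm_eq]
    refine Real.sqrt_le_sqrt ?_
    have hle : ∀ i, ‖(x : EuclideanSpace ℝ (Fin (n + 1))) i‖ ^ 2 ≤ 1 := by
      intro i
      have h0 : 0 ≤ w x i := hxK i
      have h1 : w x i ≤ 1 := by
        rw [← hw1 x]
        exact Finset.single_le_sum (fun j _ => hxK j) (Finset.mem_univ i)
      have ha1 : a ≤ 1 := by
        rw [← hna]
        exact Finset.single_le_sum (f := fun _ => a) (fun _ _ => ha.le) (Finset.mem_univ i)
      rw [sq_le_one_iff₀ (norm_nonneg _), Real.norm_eq_abs, abs_le]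
      simp only [w] at h0 h1
      constructor <;> linarith
    refine (Finset.sum_le_sum fun i _ => hle i).trans ?_
    simp
  obtain ⟨x, hx⟩ := hF.exists_eq_zero_of_eq_self_of_norm_gt hout
  split_ifs at hx with hxK
  · obtain ⟨c, hc, hc1, ⟨i, hi⟩, hcx⟩ := (mem_simplexBoundary_iff v _).1 (hrm (hAK hxK))
    let z : E := ⟨WithLp.toLp 2 fun j => c j - a, by
      change ∑ j, (c j - a) = 0
      rw [Finset.sum_sub_distrib, hc1, hna, sub_self]⟩
    have hwz : w z = c := by
      funext j
      simp [w, z]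
    have hz : z = 0 := by
      rw [← hBA z, ← hx, ← hcx]
      simp only [A, hwz]
    have : w z i = a := by simp [hz, w]
    rw [hwz, hi] at this
    exact ha.ne this
  · exact hxK fun i => by simp [hx, w, ha.le]
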